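/- Localization error of the periodized problem tends to zero: Let σ > 0, α ∈ ℝ, t < t₀, M > 0, and let φ : ℝ → ℝ be a measurable function with 0 ≤ φ(x̂) ≤ M for all x̂. For x̂* > 0 let φ_p^{x̂*} be the (8x̂*)-periodic odd-even extension of φ, defined by φ_p^{x̂*}(x̂) = φ(x̂) for x̂ ∈ [−x̂*, x̂*], φ_p^{x̂*}(x̂) = 2φ(x̂*) − φ_p^{x̂*}(2x̂* − x̂) for x̂ ∈ [x̂*, 3x̂*], φ_p^{x̂*}(x̂) = φ_p^{x̂*}(6x̂* − x̂) for x̂ ∈ [3x̂*, 7x̂*], and φ_p^{x̂*}(x̂) = φ_p^{x̂*}(x̂ − 8x̂*k) for the unique k ∈ ℤ with x̂ − 8x̂*k ∈ [−x̂*, 7x̂*]. Define the Gaussian kernel Θ(x̂', x̂) = (σ√(2π(t₀−t)))^{-1} exp(−[x̂' − (x̂ + (α − σ²/2)(t₀−t))]² / (2σ²(t₀−t))) and set R_p^{x̂*}(x̂) = ∫_ℝ φ_p^{x̂*}(x̂')Θ(x̂',x̂)dx̂' and R(x̂) = ∫_ℝ φ(x̂')Θ(x̂',x̂)dx̂'.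 Then for every L > 0 and every ε > 0 there exists x̂_ε ≥ L such that for all x̂* ≥ x̂_ε and all x̂ ∈ [−L, L], |R_p^{x̂*}(x̂) − R(x̂)| ≤ ε. -/

import Mathlib

open Real MeasureTheory

noncomputable section

/-- Equispaced nodes `x_j = jπ/N`. -/
def node (N : ℕ) (j : ℕ) : ℝ := j * Real.pi / N

/-- The trigonometric polynomial `x ↦ Σ_{k=-N}^{N-1} c_k e^{ikx}`. -/
def trigPoly (N : ℕ) (c : ℤ → ℂ) : ℝ → ℂ := fun x =>
  ∑ k ∈ Finset.Icc (-(N : ℤ)) ((N : ℤ) - 1), c k * Complex.exp (Complex.I * k * x)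

/-- Membership in the space `S_N` of trigonometric polynomials of degree `N`. -/
def memSN (N : ℕ) (v : ℝ → ℂ) : Prop := ∃ c : ℤ → ℂ, v = trigPoly N c

/-- Discrete Fourier transform coefficients of `u` at the `2N` equispaced nodes. -/
def dftCoeff (N : ℕ) (u : ℝ → ℂ) (k : ℤ) : ℂ :=
  (1 / (2 * N : ℂ)) *
    ∑ j ∈ Finset.range (2 * N), u (node N j) * Complex.exp (-(Complex.I * k * node N j))

/-- The trigonometric interpolant `I_N(u) ∈ S_N` of `u` at the equispaced nodes. -/
def interp (N : ℕ) (u : ℝ → ℂ) : ℝ → ℂ := trigPoly N (dftCoeff N u)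

/-- The `L²(0, 2π)` norm. -/
def l2norm {E : Type*} [NormedAddCommGroup E] (v : ℝ → E) : ℝ :=
  Real.sqrt (∫ x in (0:ℝ)..(2 * Real.pi), ‖v x‖ ^ 2)

/-- The sup norm over `[0, 2π]`. -/
def supNorm {E : Type*} [NormedAddCommGroup E] (v : ℝ → E) : ℝ :=
  ⨆ x : Set.Icc (0:ℝ) (2 * Real.pi), ‖v x.1‖

/-- `u` has the (pointwise convergent) Fourier expansion with coefficients `c`. -/
def hasFourierCoeffs (u : ℝ → ℂ) (c : ℤ → ℂ) : Prop :=
  ∀ x : ℝ, HasSum (fun k : ℤ => c k * Complex.exp (Complex.I * k * x)) (u x)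

/-- Membership in the periodic Sobolev space `H^m_p`, expressed via Fourier coefficients. -/
def inHp (m : ℕ) (c : ℤ → ℂ) : Prop :=
  Summable fun k : ℤ => (|k| : ℝ) ^ (2 * m) * ‖c k‖ ^ 2

/-- `‖∂^m u/∂x^m‖ = (2π Σ_k |k|^{2m}|c_k|²)^{1/2}` for `u` with Fourier coefficients `c`. -/
def sobNorm (m : ℕ) (c : ℤ → ℂ) : ℝ :=
  Real.sqrt (2 * Real.pi * ∑' k : ℤ, (|k| : ℝ) ^ (2 * m) * ‖c k‖ ^ 2)

/-- The odd-even extension of `φ` on one period `[−x̂*, 7x̂*]`: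
`φ` on `[−x̂*, x̂*]`, `2φ(x̂*) − φ_p(2x̂* − ŷ)` on `(x̂*, 3x̂*]`, and
`φ_p(6x̂* − ŷ)` on `(3x̂*, 7x̂*]` (the recursion is unfolded). -/
def oeExtCore (xs : ℝ) (φ : ℝ → ℝ) (y : ℝ) : ℝ :=
  if y ≤ xs then φ y
  else if y ≤ 3 * xs then 2 * φ xs - φ (2 * xs - y)
  else if 6 * xs - y ≤ xs then φ (6 * xs - y)
  else 2 * φ xs - φ (y - 4 * xs)

/-- The `(8x̂*)`-periodic odd-even extension `φ_p^{x̂*}` of `φ`. -/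
def perExt (xs : ℝ) (φ : ℝ → ℝ) (x : ℝ) : ℝ :=
  oeExtCore xs φ (x + xs - 8 * xs * (⌊(x + xs) / (8 * xs)⌋ : ℤ) - xs)

/-- The Gaussian kernel `Θ(x̂', x̂)` of the backward heat-transport equation. -/
def gaussKer (σ α t t₀ : ℝ) (x' x : ℝ) : ℝ :=
  (σ * Real.sqrt (2 * Real.pi * (t₀ - t)))⁻¹ *
    Real.exp (-(x' - (x + (α - σ ^ 2 / 2) * (t₀ - t))) ^ 2 / (2 * σ ^ 2 * (t₀ - t)))

/-- `R_p^{x̂*}(x̂) = ∫ φ_p^{x̂*}(x̂')Θ(x̂',x̂)dx̂'`. -/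
def Rper (σ α t t₀ xs : ℝ) (φ : ℝ → ℝ) (x : ℝ) : ℝ :=
  ∫ x' : ℝ, perExt xs φ x' * gaussKer σ α t t₀ x' x

/-- `R(x̂) = ∫ φ(x̂')Θ(x̂',x̂)dx̂'`. -/
def Rfun (σ α t t₀ : ℝ) (φ : ℝ → ℝ) (x : ℝ) : ℝ :=
  ∫ x' : ℝ, φ x' * gaussKer σ α t t₀ x' x

theorem integrable_gaussKer {σ t t₀ : ℝ} (hσ : 0 < σ) (ht : t < t₀) (α x : ℝ) :
    Integrable fun x' => gaussKer σ α t t₀ x' x := by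
  have hb : 0 < (2 * σ ^ 2 * (t₀ - t))⁻¹ := by
    have := sub_pos.2 ht
    positivity
  have h := ((integrable_exp_neg_mul_sq hb).comp_sub_right
    (x + (α - σ ^ 2 / 2) * (t₀ - t))).const_mul (σ * Real.sqrt (2 * Real.pi * (t₀ - t)))⁻¹
  refine h.congr (Filter.Eventually.of_forall fun y => ?_)
  simp only [gaussKer]
  congr 2
  ring

theorem gaussKer_nonneg {σ : ℝ} (hσ : 0 < σ) (α t t₀ x' x : ℝ) :
    0 ≤ gaussKer σ α t t₀ x' x := by
  unfold gaussKer
  positivity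

theorem gaussKer_add_right (σ α t t₀ z x : ℝ) :
    gaussKer σ α t t₀ (z + x) x = gaussKer σ α t t₀ z 0 := by
  simp only [gaussKer]
  congr 4
  ring

theorem measurable_perExt {φ : ℝ → ℝ} (hφ : Measurable φ) (xs : ℝ) :
    Measurable (perExt xs φ) := by
  have hcore : Measurable (oeExtCore xs φ) := by
    unfold oeExtCore
    refine Measurable.ite measurableSet_Iic hφ ?_
    refine Measurable.ite measurableSet_Iic (by fun_prop) ?_
    exact Measurable.ite (measurableSet_le (by fun_prop) measurable_const)
      (by fun_prop) (by fun_prop)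
  have hfloor : Measurable fun x : ℝ => ((⌊(x + xs) / (8 * xs)⌋ : ℤ) : ℝ) :=
    (measurable_from_top (f := fun n : ℤ => (n : ℝ))).comp
      (Int.measurable_floor.comp (by fun_prop))
  exact hcore.comp (by fun_prop)

theorem abs_perExt_le {φ : ℝ → ℝ} {M : ℝ} (hφ : ∀ x, 0 ≤ φ x ∧ φ x ≤ M) (xs x : ℝ) :
    |perExt xs φ x| ≤ 2 * M := by
  unfold perExt oeExtCore
  generalize x + xs - 8 * xs * (⌊(x + xs) / (8 * xs)⌋ : ℤ) - xs = y
  have h₁ := hφ xs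
  have h₂ := hφ y
  have h₃ := hφ (2 * xs - y)
  have h₄ := hφ (6 * xs - y)
  have h₅ := hφ (y - 4 * xs)
  rw [abs_le]
  split_ifs <;> constructor <;> linarith

theorem perExt_eq_self {xs x : ℝ} (φ : ℝ → ℝ) (hxs : 0 < xs) (hx : |x| ≤ xs) :
    perExt xs φ x = φ x := by
  obtain ⟨h₁, h₂⟩ := abs_le.1 hx
  have hfloor : ⌊(x + xs) / (8 * xs)⌋ = 0 := by
    rw [Int.floor_eq_zero_iff]
    exact ⟨div_nonneg (by linarith) (by linarith), (div_lt_one (by linarith)).2 (by linarith)⟩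
  simp [perExt, oeExtCore, hfloor, h₂]

theorem tendsto_setIntegral_lt_abs {g : ℝ → ℝ} (hg : Integrable g) :
    Filter.Tendsto (fun r : ℝ => ∫ z in {z | r < |z|}, g z) Filter.atTop (nhds 0) := by
  have hmeas (r : ℝ) : MeasurableSet {z : ℝ | r < |z|} :=
    measurableSet_lt measurable_const (by fun_prop)
  simp_rw [← integral_indicator (hmeas _)]
  rw [← integral_zero ℝ ℝ (μ := volume)]
  refine tendsto_integral_filter_of_dominated_convergence (fun z => ‖g z‖) ?_ ?_ hg.norm ?_
  · exact Filter.Eventually.of_forall fun r => (hg.indicator (hmeas r)).aestronglyMeasurable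
  · exact Filter.Eventually.of_forall fun r => Filter.Eventually.of_forall fun z =>
      norm_indicator_le_norm_self _ _
  · refine Filter.Eventually.of_forall fun z => tendsto_const_nhds.congr' ?_
    filter_upwards [Filter.eventually_ge_atTop |z|] with r hr
    exact (Set.indicator_of_notMem (by simpa using hr) _).symm

theorem abs_Rper_sub_Rfun_le {σ α t t₀ M : ℝ} (hσ : 0 < σ) (ht : t < t₀)
    {φ : ℝ → ℝ} (hmeas : Measurable φ) (hφ : ∀ x : ℝ, 0 ≤ φ x ∧ φ x ≤ M)
    {L xs x : ℝ} (hxs : 0 < xs) (hx : |x| ≤ L) :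
    |Rper σ α t t₀ xs φ x - Rfun σ α t t₀ φ x| ≤
      3 * M * ∫ z in {z | xs - L < |z|}, gaussKer σ α t t₀ z 0 := by
  have hset : MeasurableSet {z : ℝ | xs - L < |z|} :=
    measurableSet_lt measurable_const (by fun_prop)
  have hK := integrable_gaussKer hσ ht α x
  have hp : Integrable fun y => perExt xs φ y * gaussKer σ α t t₀ y x :=
    hK.bdd_mul (measurable_perExt hmeas xs).aestronglyMeasurable
      (Filter.Eventually.of_forall (abs_perExt_le hφ xs))
  have hq : Integrable fun y => φ y * gaussKer σ α t t₀ y x :=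
    hK.bdd_mul (c := M) hmeas.aestronglyMeasurable (Filter.Eventually.of_forall fun y => by
      rw [Real.norm_of_nonneg (hφ y).1]
      exact (hφ y).2)
  rw [Rper, Rfun, ← integral_sub hp hq, ← integral_add_right_eq_self _ x,
    ← integral_const_mul, ← integral_indicator hset, ← Real.norm_eq_abs]
  refine norm_integral_le_of_norm_le
    (((integrable_gaussKer hσ ht α 0).const_mul _).indicator hset)
    (Filter.Eventually.of_forall fun z => ?_)
  rw [gaussKer_add_right, ← sub_mul, norm_mul,
    Real.norm_of_nonneg (gaussKer_nonneg hσ α t t₀ z 0), Real.norm_eq_abs]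
  by_cases hz : xs - L < |z|
  · rw [Set.indicator_of_mem (by exact hz)]
    refine mul_le_mul_of_nonneg_right ?_ (gaussKer_nonneg hσ α t t₀ z 0)
    have h₁ := abs_le.1 (abs_perExt_le hφ xs (z + x))
    have h₂ := hφ (z + x)
    exact abs_le.2 ⟨by linarith, by linarith⟩
  · rw [Set.indicator_of_notMem (by exact hz), perExt_eq_self φ hxs, sub_self, abs_zero, zero_mul]
    have := abs_add_le z x
    linarith

/-- Localization error of the periodized problem tends to zero. -/
theorem localization_error_tendsto_zero
    (σ α t t₀ M : ℝ) (hσ : 0 < σ) (ht : t < t₀) (hM : 0 < M)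
    (φ : ℝ → ℝ) (hmeas : Measurable φ) (hφ : ∀ x : ℝ, 0 ≤ φ x ∧ φ x ≤ M) :
    ∀ L > (0:ℝ), ∀ ε > (0:ℝ), ∃ xε : ℝ, L ≤ xε ∧
      ∀ xs : ℝ, xε ≤ xs → ∀ x ∈ Set.Icc (-L) L,
        |Rper σ α t t₀ xs φ x - Rfun σ α t t₀ φ x| ≤ ε := by
  intro L hL ε hε
  have hlim := ((tendsto_setIntegral_lt_abs (integrable_gaussKer hσ ht α 0)).const_mul (3 * M)).comp
    (Filter.tendsto_atTop_add_const_right Filter.atTop (-L) Filter.tendsto_id)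
  rw [mul_zero] at hlim
  obtain ⟨r, hr⟩ := Filter.eventually_atTop.1 (hlim.eventually_le_const hε)
  refine ⟨max L r, le_max_left _ _, fun xs hxs x hx => ?_⟩
  have hLxs : L ≤ xs := (le_max_left _ _).trans hxs
  exact (abs_Rper_sub_Rfun_le hσ ht hmeas hφ (hL.trans_le hLxs) (abs_le.2 hx)).trans
    (hr xs ((le_max_right _ _).trans hxs))

end
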